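/- Let H' = ⊕_{j=1}^n A_j ⊗ B_j be a finite-dimensional complex Hilbert space, where each A_j has dimension D and each B_j has dimension D_α, so K = dim H' = n·D·D_α; let Π_j be the orthogonal projector onto the j-th summand, and define F(ρ) = Σ_{j=1}^n Tr_{A_j}(Π_j ρ Π_j), a density operator on ⊕_{j=1}^n B_j. Fix a unit vector φ₀ ∈ H'. Then the Haar average over the unitary group U(K) of H' satisfies ∫_{U(K)} Tr[ F(U |φ₀⟩⟨φ₀| U†)² ] dU = n(D² D_α + D_α² D)/(K(K+1)). -/

import Mathlib

open Matrix MeasureTheory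
open scoped BigOperators

noncomputable section

/-- Matrices over `ℂ` are measurable via the entrywise (pi-type) σ-algebra. -/
instance matrixMeasurableSpace {m n : Type*} : MeasurableSpace (Matrix m n ℂ) :=
  (inferInstance : MeasurableSpace (m → n → ℂ))

/-- The rank-one projector `|v⟩⟨v|` of a vector `v`. -/
def rankOne {n : Type*} (v : n → ℂ) : Matrix n n ℂ := Matrix.vecMulVec v (star v)

/-- The Euclidean (Hilbert-space) norm of a vector. -/
def evnorm {n : Type*} [Fintype n] (v : n → ℂ) : ℝ := Real.sqrt (∑ i, ‖v i‖ ^ 2)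

/-- On `H' = ⊕_{j=1}^n A_j ⊗ B_j` (with `dim A_j = D`, `dim B_j = D_α`, basis indexed by
`Fin n × Fin D × Fin Dα`), the map `F(ρ) = Σ_j Tr_{A_j}(Π_j ρ Π_j)`, an operator on
`⊕_j B_j` (basis indexed by `Fin n × Fin Dα`). -/
def Fmap (n D Dα : ℕ) (ρ : Matrix (Fin n × Fin D × Fin Dα) (Fin n × Fin D × Fin Dα) ℂ) :
    Matrix (Fin n × Fin Dα) (Fin n × Fin Dα) ℂ :=
  Matrix.of fun p q =>
    if p.1 = q.1 then ∑ m : Fin D, ρ (p.1, m, p.2) (p.1, m, q.2) else 0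

end

open Matrix MeasureTheory

section aux
variable {ι : Type} [Fintype ι] [DecidableEq ι]

theorem aux_measurable_entry (i j : ι) :
    Measurable (fun U : Matrix.unitaryGroup ι ℂ => (U : Matrix ι ι ℂ) i j) := by
  have h1 : Measurable (fun M : Matrix ι ι ℂ => M i j) :=
    (measurable_pi_apply j).comp (measurable_pi_apply (X := fun _ : ι => ι → ℂ) i)
  exact h1.comp measurable_subtype_coe

theorem aux_measurableMul : MeasurableMul (Matrix.unitaryGroup ι ℂ) where
  measurable_const_mul g := by
    refine Measurable.subtype_mk ?_
    refine measurable_pi_iff.2 fun i => measurable_pi_iff.2 fun j => ?_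
    show Measurable fun U : Matrix.unitaryGroup ι ℂ => ((g : Matrix ι ι ℂ) * (U : Matrix ι ι ℂ)) i j
    simp only [Matrix.mul_apply]
    exact Finset.measurable_sum _ fun k _ => (aux_measurable_entry k j).const_mul _
  measurable_mul_const g := by
    refine Measurable.subtype_mk ?_
    refine measurable_pi_iff.2 fun i => measurable_pi_iff.2 fun j => ?_
    show Measurable fun U : Matrix.unitaryGroup ι ℂ => ((U : Matrix ι ι ℂ) * (g : Matrix ι ι ℂ)) i j
    simp only [Matrix.mul_apply]
    exact Finset.measurable_sum _ fun k _ => (aux_measurable_entry i k).mul_const _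

theorem aux_norm (φ : ι → ℂ) (U : Matrix.unitaryGroup ι ℂ) :
    ∑ i, ‖((U : Matrix ι ι ℂ) *ᵥ φ) i‖ ^ 2 = ∑ i, ‖φ i‖ ^ 2 := by
  have key : ∀ v : ι → ℂ, ((∑ i, ‖v i‖ ^ 2 : ℝ) : ℂ) = star v ⬝ᵥ v := by
    intro v
    simp [dotProduct, Complex.conj_mul']
  have : star ((U : Matrix ι ι ℂ) *ᵥ φ) ⬝ᵥ ((U : Matrix ι ι ℂ) *ᵥ φ) = star φ ⬝ᵥ φ := by
    rw [Matrix.star_mulVec, Matrix.dotProduct_mulVec, Matrix.vecMul_vecMul]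
    have h : (U : Matrix ι ι ℂ)ᴴ * (U : Matrix ι ι ℂ) = 1 := Matrix.UnitaryGroup.star_mul_self U
    rw [h, Matrix.vecMul_one]
  rw [← key, ← key] at this
  exact_mod_cast this

theorem aux_integrable {E : Type} [NormedAddCommGroup E] [SecondCountableTopology E]
    (ν : Measure (Matrix.unitaryGroup ι ℂ)) [IsProbabilityMeasure ν]
    (φ : ι → ℂ) (hφ : ∑ i, ‖φ i‖ ^ 2 = 1) (f : (ι → ℂ) → E) (hf : Continuous f) :
    Integrable (fun U : Matrix.unitaryGroup ι ℂ => f ((U : Matrix ι ι ℂ) *ᵥ φ)) ν := by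
  borelize E
  have hm : Measurable (fun U : Matrix.unitaryGroup ι ℂ => (U : Matrix ι ι ℂ) *ᵥ φ) := by
    refine measurable_pi_iff.2 fun i => ?_
    simp only [Matrix.mulVec, dotProduct]
    exact Finset.measurable_sum _ fun k _ => (aux_measurable_entry i k).mul_const _
  obtain ⟨C, hC⟩ := (isCompact_closedBall (0 : ι → ℂ) 1).exists_bound_of_continuousOn hf.continuousOn
  refine Integrable.of_bound (hf.measurable.comp hm).aestronglyMeasurable C
    (Filter.Eventually.of_forall fun U => hC _ ?_)
  rw [mem_closedBall_zero_iff, pi_norm_le_iff_of_nonneg zero_le_one]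
  intro i
  have h := aux_norm φ U
  rw [hφ] at h
  have h2 := Finset.single_le_sum (f := fun i => ‖((U : Matrix ι ι ℂ) *ᵥ φ) i‖ ^ 2)
    (fun i _ => by positivity) (Finset.mem_univ i)
  simp only [h] at h2
  nlinarith [norm_nonneg (((U : Matrix ι ι ℂ) *ᵥ φ) i)]

theorem aux_unitary (w : ι → ℂ) (c s : ℂ) (hs : star w ⬝ᵥ w = s) (hc : c + star c = s * c * star c) :
    (1 - c • vecMulVec w (star w)) ∈ Matrix.unitaryGroup ι ℂ := by
  rw [Matrix.mem_unitaryGroup_iff]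
  have h1 : star (vecMulVec w (star w)) = vecMulVec w (star w) := by
    ext i j
    simp [Matrix.star_apply, vecMulVec_apply, mul_comm]
  have h2 : vecMulVec w (star w) * vecMulVec w (star w) = s • vecMulVec w (star w) := by
    rw [vecMulVec_mul_vecMulVec, hs]
    ext i j
    simp [vecMulVec_apply]
    try ring
  rw [star_sub, star_one, star_smul, h1]
  rw [sub_mul, mul_sub, mul_sub, one_mul, one_mul, mul_one, smul_mul_smul_comm, h2, smul_smul]
  have h3 : c * star c * s = c + star c := by rw [hc]; ring
  rw [h3, add_smul]
  abel

theorem aux_invariant {E : Type} [NormedAddCommGroup E] [NormedSpace ℝ E]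
    (ν : Measure (Matrix.unitaryGroup ι ℂ)) [ν.IsMulLeftInvariant]
    (φ : ι → ℂ) (f : (ι → ℂ) → E) (w : ι → ℂ) (c s : ℂ)
    (hs : star w ⬝ᵥ w = s) (hc : c + star c = s * c * star c) :
    ∫ U : Matrix.unitaryGroup ι ℂ, f ((U : Matrix ι ι ℂ) *ᵥ φ) ∂ν =
    ∫ U : Matrix.unitaryGroup ι ℂ, f (fun i => ((U : Matrix ι ι ℂ) *ᵥ φ) i
      - c * w i * (star w ⬝ᵥ ((U : Matrix ι ι ℂ) *ᵥ φ))) ∂ν := by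
  have := aux_measurableMul (ι := ι)
  rw [← integral_mul_left_eq_self _ (⟨_, aux_unitary w c s hs hc⟩ : Matrix.unitaryGroup ι ℂ)]
  congr 1
  ext U
  congr 1
  ext i
  show (((1 - c • vecMulVec w (star w)) * (U : Matrix ι ι ℂ)) *ᵥ φ) i = _
  rw [← Matrix.mulVec_mulVec, Matrix.sub_mulVec, Matrix.one_mulVec, Matrix.smul_mulVec,
    Matrix.vecMulVec_mulVec]
  simp
  try ring

theorem aux_four (X Y : ℂ) :
    ‖X + Y‖ ^ 4 + ‖X - Y‖ ^ 4 + ‖X + Complex.I * Y‖ ^ 4 + ‖X - Complex.I * Y‖ ^ 4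
     = 4 * (‖X‖ ^ 4 + ‖Y‖ ^ 4 + 4 * (‖X‖ ^ 2 * ‖Y‖ ^ 2)) := by
  have h : ∀ z : ℂ, ‖z‖ ^ 4 = (z.re * z.re + z.im * z.im) ^ 2 := by
    intro z
    rw [← Complex.normSq_apply, Complex.normSq_eq_norm_sq]; ring
  have h2 : ∀ z : ℂ, ‖z‖ ^ 2 = (z.re * z.re + z.im * z.im) := by
    intro z
    rw [← Complex.normSq_apply, Complex.normSq_eq_norm_sq]
  simp only [h, h2]
  simp
  ring

theorem aux_rot (ν : Measure (Matrix.unitaryGroup ι ℂ)) [ν.IsMulLeftInvariant]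
    (φ : ι → ℂ) (x y : ι) (hxy : x ≠ y) (ω : ℂ) (hω : star ω * ω = 1) :
    ∫ U : Matrix.unitaryGroup ι ℂ, ‖((U : Matrix ι ι ℂ) *ᵥ φ) x‖ ^ 4 ∂ν =
    ∫ U : Matrix.unitaryGroup ι ℂ, (1 / 4 : ℝ) * ‖((U : Matrix ι ι ℂ) *ᵥ φ) x +
      Complex.I * star ω * ((U : Matrix ι ι ℂ) *ᵥ φ) y‖ ^ 4 ∂ν := by
  have hyx := hxy.symm
  rw [aux_invariant ν φ (fun v => ‖v x‖ ^ 4) (Pi.single x 1 + Pi.single y ω) ((1 - Complex.I) / 2) 2]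
  · congr 1
    ext U
    have hs : star (Pi.single x 1 + Pi.single y ω : ι → ℂ) ⬝ᵥ ((U : Matrix ι ι ℂ) *ᵥ φ)
        = ((U : Matrix ι ι ℂ) *ᵥ φ) x + star ω * ((U : Matrix ι ι ℂ) *ᵥ φ) y := by
      rw [star_add, add_dotProduct, ← Pi.single_star, ← Pi.single_star]
      simp
    rw [hs]
    beta_reduce
    generalize ((U : Matrix ι ι ℂ) *ᵥ φ) x = X
    generalize ((U : Matrix ι ι ℂ) *ᵥ φ) y = Y
    have : X - (1 - Complex.I) / 2 * (Pi.single x 1 + Pi.single y ω : ι → ℂ) x * (X + star ω * Y)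
      = (1 + Complex.I) / 2 * (X + Complex.I * star ω * Y) := by
      simp [hxy]
      linear_combination (- (starRingEnd ℂ) ω * Y / 2) * Complex.I_sq
    rw [this, norm_mul, mul_pow]
    congr 1
    have : ‖(1 + Complex.I) / 2‖ ^ 2 = 1 / 2 := by
      rw [← Complex.normSq_eq_norm_sq, Complex.normSq_apply]
      simp; norm_num
    rw [show (4 : ℕ) = 2 * 2 from rfl, pow_mul, this]; norm_num
  · rw [star_add, add_dotProduct, ← Pi.single_star, ← Pi.single_star]
    simp [hxy, hyx]
    have : (starRingEnd ℂ) ω * ω = 1 := hω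
    rw [this]; norm_num
  · simp
    linear_combination (1 / 2) * Complex.I_sq

theorem aux_ab (ν : Measure (Matrix.unitaryGroup ι ℂ)) [IsProbabilityMeasure ν]
    [ν.IsMulLeftInvariant] (φ : ι → ℂ) (hφ : ∑ i, ‖φ i‖ ^ 2 = 1) (x y : ι) (hxy : x ≠ y) :
    4 * ∫ U : Matrix.unitaryGroup ι ℂ, ‖((U : Matrix ι ι ℂ) *ᵥ φ) x‖ ^ 4 ∂ν =
    (∫ U : Matrix.unitaryGroup ι ℂ, ‖((U : Matrix ι ι ℂ) *ᵥ φ) x‖ ^ 4 ∂ν) +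
    (∫ U : Matrix.unitaryGroup ι ℂ, ‖((U : Matrix ι ι ℂ) *ᵥ φ) y‖ ^ 4 ∂ν) +
    4 * ∫ U : Matrix.unitaryGroup ι ℂ, ‖((U : Matrix ι ι ℂ) *ᵥ φ) x‖ ^ 2 *
      ‖((U : Matrix ι ι ℂ) *ᵥ φ) y‖ ^ 2 ∂ν := by
  have h1 := aux_rot ν φ x y hxy 1 (by simp)
  have h2 := aux_rot ν φ x y hxy (-1) (by simp)
  have h3 := aux_rot ν φ x y hxy Complex.I (by simp)
  have h4 := aux_rot ν φ x y hxy (-Complex.I) (by simp)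
  have hi : ∀ ω : ℂ, Integrable (fun U : Matrix.unitaryGroup ι ℂ =>
      (1 / 4 : ℝ) * ‖((U : Matrix ι ι ℂ) *ᵥ φ) x +
      Complex.I * star ω * ((U : Matrix ι ι ℂ) *ᵥ φ) y‖ ^ 4) ν := fun ω =>
    aux_integrable ν φ hφ (fun v => (1 / 4 : ℝ) * ‖v x + Complex.I * star ω * v y‖ ^ 4)
      (by fun_prop)
  have hx := aux_integrable ν φ hφ (fun v => ‖v x‖ ^ 4) (by fun_prop)
  have hy := aux_integrable ν φ hφ (fun v => ‖v y‖ ^ 4) (by fun_prop)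
  have hb := aux_integrable ν φ hφ (fun v => ‖v x‖ ^ 2 * ‖v y‖ ^ 2) (by fun_prop)
  rw [← integral_const_mul 4 (fun U : Matrix.unitaryGroup ι ℂ =>
    ‖((U : Matrix ι ι ℂ) *ᵥ φ) x‖ ^ 2 * ‖((U : Matrix ι ι ℂ) *ᵥ φ) y‖ ^ 2)]
  rw [← integral_add' hx hy, ← integral_add' (hx.add hy) (hb.const_mul 4)]
  have h5 : 4 * ∫ U : Matrix.unitaryGroup ι ℂ, ‖((U : Matrix ι ι ℂ) *ᵥ φ) x‖ ^ 4 ∂ν = _ + _ + _ + _ :=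
    (fun t => by ring : ∀ t : ℝ, 4 * t = t + t + t + t) _ |>.trans
      (congrArg₂ (· + ·) (congrArg₂ (· + ·) (congrArg₂ (· + ·) h3 h4) h1) h2)
  rw [h5, ← integral_add' (hi _) (hi _), ← integral_add' ((hi _).add (hi _)) (hi _),
    ← integral_add' (((hi _).add (hi _)).add (hi _)) (hi _)]
  congr 1
  ext U
  have h6 := aux_four (((U : Matrix ι ι ℂ) *ᵥ φ) x) (((U : Matrix ι ι ℂ) *ᵥ φ) y)
  simp only [Pi.add_apply]
  have e1 : Complex.I * star Complex.I = 1 := by simp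
  have e2 : Complex.I * star (-Complex.I) = -1 := by simp
  rw [e1, e2]
  simp only [star_one, star_neg, mul_one, one_mul, neg_mul, mul_neg, ← sub_eq_add_neg]
  linarith

theorem aux_sum (ν : Measure (Matrix.unitaryGroup ι ℂ)) [IsProbabilityMeasure ν]
    (φ : ι → ℂ) (hφ : ∑ i, ‖φ i‖ ^ 2 = 1) :
    ∑ x, ∑ y, ∫ U : Matrix.unitaryGroup ι ℂ, ‖((U : Matrix ι ι ℂ) *ᵥ φ) x‖ ^ 2 *
      ‖((U : Matrix ι ι ℂ) *ᵥ φ) y‖ ^ 2 ∂ν = 1 := by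
  have hb := fun x y => aux_integrable ν φ hφ (fun v => ‖v x‖ ^ 2 * ‖v y‖ ^ 2) (by fun_prop)
  simp_rw [← integral_finsetSum _ fun y _ => hb _ y]
  rw [← integral_finsetSum _ fun x _ => integrable_finsetSum _ fun y _ => hb x y]
  simp_rw [← Finset.mul_sum, ← Finset.sum_mul, aux_norm, hφ]
  simp

theorem aux_moment (ν : Measure (Matrix.unitaryGroup ι ℂ)) [IsProbabilityMeasure ν]
    [ν.IsMulLeftInvariant] (φ : ι → ℂ) (hφ : ∑ i, ‖φ i‖ ^ 2 = 1) (x y : ι) :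
    ∫ U : Matrix.unitaryGroup ι ℂ, ‖((U : Matrix ι ι ℂ) *ᵥ φ) x‖ ^ 2 *
      ‖((U : Matrix ι ι ℂ) *ᵥ φ) y‖ ^ 2 ∂ν =
    (1 + if x = y then 1 else 0) / ((Fintype.card ι : ℝ) * (Fintype.card ι + 1)) := by
  have hs := aux_sum ν φ hφ
  have hab := aux_ab ν φ hφ
  have ha : ∀ x, ∫ U : Matrix.unitaryGroup ι ℂ, ‖((U : Matrix ι ι ℂ) *ᵥ φ) x‖ ^ 4 ∂ν =
    ∫ U : Matrix.unitaryGroup ι ℂ, ‖((U : Matrix ι ι ℂ) *ᵥ φ) x‖ ^ 2 *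
      ‖((U : Matrix ι ι ℂ) *ᵥ φ) x‖ ^ 2 ∂ν := by
    intro x; congr 1; ext U; ring
  have hc : ∀ x y, ∫ U : Matrix.unitaryGroup ι ℂ, ‖((U : Matrix ι ι ℂ) *ᵥ φ) x‖ ^ 2 *
      ‖((U : Matrix ι ι ℂ) *ᵥ φ) y‖ ^ 2 ∂ν = ∫ U : Matrix.unitaryGroup ι ℂ,
      ‖((U : Matrix ι ι ℂ) *ᵥ φ) y‖ ^ 2 * ‖((U : Matrix ι ι ℂ) *ᵥ φ) x‖ ^ 2 ∂ν := by
    intro x y; congr 1; ext U; ring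
  simp only [ha] at hab
  generalize hB : (fun x y => ∫ U : Matrix.unitaryGroup ι ℂ, ‖((U : Matrix ι ι ℂ) *ᵥ φ) x‖ ^ 2 *
      ‖((U : Matrix ι ι ℂ) *ᵥ φ) y‖ ^ 2 ∂ν) = B
  have hB' := fun x y => congrFun (congrFun hB x) y
  simp only [hB'] at hs hab hc ⊢
  have h1 : ∀ x' y', B x' y' = (B x x / 2) * (1 + if x' = y' then 1 else 0) := by
    have hd : ∀ x', B x' x' = B x x := by
      intro x'
      by_cases h : x' = x
      · rw [h]
      · have := hab x' x h
        have := hab x x' (Ne.symm h)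
        have := hc x x'
        linarith
    intro x' y'
    by_cases h : x' = y'
    · subst h; simp [hd]; ring
    · have := hab x' y' h
      have := hd x'
      have := hd y'
      simp [h]; linarith
  have hK : 0 < (Fintype.card ι : ℝ) := by
    exact_mod_cast Fintype.card_pos_iff.2 ⟨x⟩
  have h2 : (B x x / 2) * ((Fintype.card ι : ℝ) * (Fintype.card ι + 1)) = 1 := by
    refine Eq.trans ?_ hs
    generalize B x x / 2 = t at h1
    rw [Finset.sum_congr rfl fun x' _ => Finset.sum_congr rfl fun y' _ => h1 x' y']
    simp [← Finset.mul_sum, Finset.sum_add_distrib]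
    ring
  rw [h1, eq_div_iff (by positivity)]
  linear_combination (1 + if x = y then 1 else 0) * h2

theorem aux_zero (ν : Measure (Matrix.unitaryGroup ι ℂ))
    [ν.IsMulLeftInvariant] (φ : ι → ℂ) (x y z w : ι) (hy : y ≠ x) (hz : z ≠ x) (hw : w ≠ x) :
    ∫ U : Matrix.unitaryGroup ι ℂ, ((U : Matrix ι ι ℂ) *ᵥ φ) x * star (((U : Matrix ι ι ℂ) *ᵥ φ) y) *
      (((U : Matrix ι ι ℂ) *ᵥ φ) z * star (((U : Matrix ι ι ℂ) *ᵥ φ) w)) ∂ν = 0 := by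
  have h := aux_invariant ν φ (fun v => v x * star (v y) * (v z * star (v w))) (Pi.single x 1) 2 1
    (by rw [← Pi.single_star]; simp) (by simp; norm_num)
  have hs : ∀ v : ι → ℂ, star (Pi.single x 1 : ι → ℂ) ⬝ᵥ v = v x := by
    intro v
    rw [← Pi.single_star]; simp
  simp only [hs, Pi.single_eq_same, Pi.single_eq_of_ne hy, Pi.single_eq_of_ne hz,
    Pi.single_eq_of_ne hw] at h
  have h2 : ∀ X Y Z W : ℂ, (X - 2 * 1 * X) * star (Y - 2 * 0 * X) *
    ((Z - 2 * 0 * X) * star (W - 2 * 0 * X)) = -(X * star Y * (Z * star W)) := by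
    intro X Y Z W
    simp only [mul_zero, zero_mul, sub_zero]; ring
  simp only [h2, integral_neg] at h
  linear_combination (1 / 2) * h

end aux

theorem aux_T {n D Dα : ℕ}
    (ν : Measure (Matrix.unitaryGroup (Fin n × Fin D × Fin Dα) ℂ))
    [IsProbabilityMeasure ν] [ν.IsMulLeftInvariant]
    (φ : Fin n × Fin D × Fin Dα → ℂ) (hφ : ∑ i, ‖φ i‖ ^ 2 = 1)
    (j : Fin n) (m m' : Fin D) (b b' : Fin Dα) :
    ∫ U : Matrix.unitaryGroup (Fin n × Fin D × Fin Dα) ℂ,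
      (U.1 *ᵥ φ) (j, m, b) * star ((U.1 *ᵥ φ) (j, m, b')) *
      ((U.1 *ᵥ φ) (j, m', b') * star ((U.1 *ᵥ φ) (j, m', b))) ∂ν
    = ((if b = b' then 1 else 0) + (if m = m' then 1 else 0)) /
      ((n * D * Dα : ℂ) * ((n * D * Dα : ℂ) + 1)) := by
  have hm := fun x y => congrArg (fun t : ℝ => (t : ℂ)) (aux_moment ν φ hφ x y)
  simp only [← integral_complex_ofReal] at hm
  have hn : ∀ z : ℂ, z * (starRingEnd ℂ) z = (‖z‖ : ℂ) ^ 2 := Complex.mul_conj'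
  by_cases hb : b = b'
  · subst hb
    have := hm (j, m, b) (j, m', b)
    simp [← mul_assoc] at this
    simp only [Complex.star_def, hn]
    rw [this]
    split_ifs <;> simp [mul_assoc]
  · by_cases hmm : m = m'
    · subst hmm
      have := hm (j, m, b) (j, m, b')
      simp [hb, ← mul_assoc] at this
      simp only [Complex.star_def]
      have e : ∀ X Y : ℂ, X * (starRingEnd ℂ) Y * (Y * (starRingEnd ℂ) X)
        = (‖X‖ : ℂ) ^ 2 * (‖Y‖ : ℂ) ^ 2 := by
        intro X Y; rw [← hn, ← hn]; ring
      simp only [e]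
      simpa [hb, ← mul_assoc] using this
    · rw [aux_zero]
      · simp [hb, hmm]
      · simp [Ne.symm hb]
      · simp [Ne.symm hb]
      · simp [Ne.symm hmm]

theorem aux_trace (n D Dα : ℕ) (φ : Fin n × Fin D × Fin Dα → ℂ)
    (U : Matrix (Fin n × Fin D × Fin Dα) (Fin n × Fin D × Fin Dα) ℂ) :
    (Fmap n D Dα (U * rankOne φ * Uᴴ) * Fmap n D Dα (U * rankOne φ * Uᴴ)).trace =
    ∑ j : Fin n, ∑ b : Fin Dα, ∑ b' : Fin Dα, ∑ m : Fin D, ∑ m' : Fin D,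
      (U *ᵥ φ) (j, m, b) * star ((U *ᵥ φ) (j, m, b')) *
      ((U *ᵥ φ) (j, m', b') * star ((U *ᵥ φ) (j, m', b))) := by
  have h : U * rankOne φ * Uᴴ = vecMulVec (U *ᵥ φ) (star (U *ᵥ φ)) := by
    rw [rankOne, Matrix.mul_vecMulVec, Matrix.vecMulVec_mul, Matrix.star_mulVec]
  rw [h]
  generalize U *ᵥ φ = v
  simp only [Matrix.trace, Matrix.diag, Matrix.mul_apply, Fmap, Matrix.of_apply, vecMulVec_apply,
    Fintype.sum_prod_type, Pi.star_apply]
  refine Finset.sum_congr rfl fun j _ => Finset.sum_congr rfl fun b _ => ?_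
  rw [Finset.sum_eq_single j]
  · refine Finset.sum_congr rfl fun b' _ => ?_
    simp [Finset.sum_mul_sum]
  · intro k _ hk
    simp [hk.symm]
  · simp

/-- Let `H' = ⊕_{j=1}^n A_j ⊗ B_j` with `dim A_j = D`, `dim B_j = D_α`, and
`K = dim H' = n·D·D_α`; let `F(ρ) = Σ_j Tr_{A_j}(Π_j ρ Π_j)`.  For a fixed unit vector
`φ₀ ∈ H'` and `U` Haar-distributed on the unitary group `U(K)` of `H'`,
`∫ Tr[F(U|φ₀⟩⟨φ₀|U†)²] dU = n (D² D_α + D_α² D) / (K (K + 1))`. -/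
theorem haar_average_trace_F_squared
    (n D Dα : ℕ)
    (ν : MeasureTheory.Measure (Matrix.unitaryGroup (Fin n × Fin D × Fin Dα) ℂ))
    [MeasureTheory.IsProbabilityMeasure ν] [ν.IsMulLeftInvariant]
    (φ₀ : Fin n × Fin D × Fin Dα → ℂ) (hφ₀ : evnorm φ₀ = 1) :
    (∫ U, (Fmap n D Dα
        ((U : Matrix (Fin n × Fin D × Fin Dα) (Fin n × Fin D × Fin Dα) ℂ) * rankOne φ₀ *
          (U : Matrix (Fin n × Fin D × Fin Dα) (Fin n × Fin D × Fin Dα) ℂ)ᴴ) *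
      Fmap n D Dα
        ((U : Matrix (Fin n × Fin D × Fin Dα) (Fin n × Fin D × Fin Dα) ℂ) * rankOne φ₀ *
          (U : Matrix (Fin n × Fin D × Fin Dα) (Fin n × Fin D × Fin Dα) ℂ)ᴴ)).trace ∂ν)
    = (n * (D^2 * Dα + Dα^2 * D) : ℂ) /
        ((n*D*Dα : ℂ) * ((n*D*Dα : ℂ) + 1)) := by
  have hφ : ∑ i, ‖φ₀ i‖ ^ 2 = 1 := by
    have := hφ₀
    rwa [evnorm, Real.sqrt_eq_one] at this
  simp only [aux_trace]
  have hi := fun (j : Fin n) (b b' : Fin Dα) (m m' : Fin D) =>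
    aux_integrable ν φ₀ hφ (fun v => v (j, m, b) * star (v (j, m, b')) *
      (v (j, m', b') * star (v (j, m', b)))) (by fun_prop)
  rw [integral_finsetSum _ fun j _ => integrable_finsetSum _ fun b _ => integrable_finsetSum _
    fun b' _ => integrable_finsetSum _ fun m _ => integrable_finsetSum _ fun m' _ => hi j b b' m m']
  simp_rw [integral_finsetSum _ fun b _ => integrable_finsetSum _
    fun b' _ => integrable_finsetSum _ fun m _ => integrable_finsetSum _ fun m' _ => hi _ b b' m m']
  simp_rw [integral_finsetSum _
    fun b' _ => integrable_finsetSum _ fun m _ => integrable_finsetSum _ fun m' _ => hi _ _ b' m m']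
  simp_rw [integral_finsetSum _ fun m _ => integrable_finsetSum _ fun m' _ => hi _ _ _ m m']
  simp_rw [integral_finsetSum _ fun m' _ => hi _ _ _ _ m']
  simp only [aux_T ν φ₀ hφ]
  simp only [← Finset.sum_div]
  congr 1
  simp [Finset.sum_add_distrib]
  ring
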